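/- (Corollary 3.2, comparison form.) Fix integers n ≥ 3, m ≥ 1, N ≥ 1 and let p ∈ (1, n/2). Then there exists a constant c > 0 such that for every φ ∈ C_c^∞(ℝ^(n+m)) and every word α ∈ {1,…,n+m}^(N+3) one has ‖Y^α φ‖_p ≤ c · max_{β} ‖X^β φ‖_p, where the maximum is over all words β of elements of 𝒳 with |β| = N+3. -/

import Mathlib

open MeasureTheory
open scoped ENNReal NNReal

/-- Points of `ℝ^(n+m)`, written `(x, y)` with `x ∈ ℝⁿ`, `y ∈ ℝᵐ`. -/
abbrev Pt (n m : ℕ) := (Fin n → ℝ) × (Fin m → ℝ)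

/-- The partial derivative operator `∂_{x_j}`. -/
noncomputable def Dx (n m : ℕ) (j : Fin n) (f : Pt n m → ℝ) : Pt n m → ℝ :=
  fun z => fderiv ℝ f z (Pi.single j 1, 0)

/-- The partial derivative operator `∂_{y_k}`. -/
noncomputable def Dy (n m : ℕ) (k : Fin m) (f : Pt n m → ℝ) : Pt n m → ℝ :=
  fun z => fderiv ℝ f z (0, Pi.single k 1)

/-- Index set for the family `𝒳`: either `j ∈ {1,…,n}` (giving `X_j = ∂_{x_j}`) or a pair
of a multi-index `ν ∈ ℕⁿ` with `|ν| = N` and `k ∈ {1,…,m}` (giving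
`X_{ν,k} = (N!/ν!)^(1/2) x^ν ∂_{y_k}`). -/
def XIdx (n m N : ℕ) := Fin n ⊕ ({ν : Fin n → ℕ // ∑ i, ν i = N} × Fin m)

/-- The family `𝒳` of first-order operators `X_j = ∂_{x_j}` and
`X_{ν,k} = (N!/ν!)^(1/2) x^ν ∂_{y_k}` for `|ν| = N`. -/
noncomputable def Xop (n m N : ℕ) : XIdx n m N → (Pt n m → ℝ) → (Pt n m → ℝ)
  | Sum.inl j => Dx n m j
  | Sum.inr (ν, k) => fun f z =>
      Real.sqrt ((Nat.factorial N : ℝ) / ∏ i, (Nat.factorial (ν.1 i) : ℝ)) *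
        (∏ i, z.1 i ^ ν.1 i) * Dy n m k f z

/-- Composition `Z_1 ∘ Z_2 ∘ ⋯ ∘ Z_s` of a word of operators. -/
def compOps {n m : ℕ} (l : List ((Pt n m → ℝ) → (Pt n m → ℝ))) :
    (Pt n m → ℝ) → (Pt n m → ℝ) :=
  l.foldr (· ∘ ·) id

/-- `X^α` for a word `α` of elements of `𝒳`. -/
noncomputable def Xw {n m N M : ℕ} (α : Fin M → XIdx n m N) :
    (Pt n m → ℝ) → (Pt n m → ℝ) :=
  compOps (List.ofFn fun i => Xop n m N (α i))

/-- The Gru\v{s}in operator `H_N = −Δ_x − |x|^(2N) Δ_y`. -/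
noncomputable def grusin (n m N : ℕ) (f : Pt n m → ℝ) : Pt n m → ℝ :=
  fun z => -(∑ j, Dx n m j (Dx n m j f) z) -
    (∑ i, z.1 i ^ 2) ^ N * ∑ k, Dy n m k (Dy n m k f) z

/-- The operators `Y_j = ∂_{x_j}` for `j ≤ n` and `Y_{n+l} = |x|^N ∂_{y_l}` for `l ≤ m`. -/
noncomputable def Yop (n m N : ℕ) : (Fin n ⊕ Fin m) → (Pt n m → ℝ) → (Pt n m → ℝ)
  | Sum.inl j => Dx n m j
  | Sum.inr l => fun f z => Real.sqrt (∑ i, z.1 i ^ 2) ^ N * Dy n m l f z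

/-- `Y^α` for a word `α ∈ {1,…,n+m}^M`. -/
noncomputable def Yw {n m N M : ℕ} (α : Fin M → (Fin n ⊕ Fin m)) :
    (Pt n m → ℝ) → (Pt n m → ℝ) :=
  compOps (List.ofFn fun i => Yop n m N (α i))

theorem commutator_list_prod {R ι : Type*} [Ring R] [DecidableEq ι] {x D : ι → R}
    (hxx : ∀ i j, Commute (x i) (x j))
    (hDx : ∀ i j, D i * x j = x j * D i + if i = j then 1 else 0) (i : ι) (u : List ι) :
    x i * (D i * (u.map x).prod - (u.map x).prod * D i) = u.count i • (u.map x).prod := by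
  induction u with
  | nil => simp
  | cons j u ih =>
    have h : x i * (D i * (x j * (u.map x).prod) - x j * (u.map x).prod * D i) =
        x j * (x i * (D i * (u.map x).prod - (u.map x).prod * D i)) +
          (if i = j then x j * (u.map x).prod else 0) := by
      rw [← mul_assoc (x j) (x i), ← (hxx i j).eq, ← mul_assoc (D i), hDx]
      split_ifs with hij
      · subst hij; noncomm_ring
      · noncomm_ring
    rw [List.map_cons, List.prod_cons, h, ih, List.count_cons, add_smul]
    by_cases hij : i = j
    · simp [hij, -nsmul_eq_mul]
    · simp [hij, Ne.symm hij, -nsmul_eq_mul]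

theorem list_prod_mul_list_prod_mem_pow {R ι κ : Type*} [Ring R] [Algebra ℝ R] [Nonempty ι]
    [DecidableEq ι]
    {x D : ι → R} {e : κ → R} (hxx : ∀ i j, Commute (x i) (x j))
    (hxe : ∀ i k, Commute (x i) (e k)) (hDe : ∀ i k, Commute (D i) (e k))
    (hDx : ∀ i j, D i * x j = x j * D i + if i = j then 1 else 0)
    {W : Submodule ℝ R} {N : ℕ} (hD : ∀ i, D i ∈ W)
    (hW : ∀ u : List ι, u.length = N → ∀ k, (u.map x).prod * e k ∈ W)
    (r : ℕ) (u : List ι) (b : List κ) (h : u.length + r = N * b.length) :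
    (u.map x).prod * (b.map e).prod ∈ W ^ (r + b.length) := by
  induction r generalizing u with
  | zero =>
    induction b generalizing u with
    | nil =>
      obtain rfl : u = [] := by simpa using h
      simpa using ⟨1, map_one _⟩
    | cons k b ih =>
      have hlen : u.length = N * b.length + N := by simpa [mul_add] using h
      have hc : Commute ((u.drop N).map x).prod (e k) := by
        refine Commute.list_prod_left _ _ fun y hy => ?_
        obtain ⟨i, -, rfl⟩ := List.mem_map.1 hy
        exact hxe i k
      have hu : (u.map x).prod = ((u.take N).map x).prod * ((u.drop N).map x).prod := by
        rw [← List.prod_append, ← List.map_append, List.take_append_drop]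
      have hprod : (u.map x).prod * ((k :: b).map e).prod =
          (((u.take N).map x).prod * e k) * (((u.drop N).map x).prod * (b.map e).prod) := by
        rw [hu, List.map_cons, List.prod_cons]
        simp only [mul_assoc]
        rw [← mul_assoc _ (e k), hc.eq, mul_assoc]
      rw [hprod, List.length_cons, show 0 + (b.length + 1) = 1 + (0 + b.length) by ring, pow_add,
        pow_one]
      exact Submodule.mul_mem_mul (hW _ (by simp [hlen]) k) (ih _ (by simp [hlen]))
  | succ r ih =>
    obtain ⟨i⟩ := ‹Nonempty ι›
    have hc : Commute (D i) (b.map e).prod := by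
      refine Commute.list_prod_right _ _ fun y hy => ?_
      obtain ⟨k, -, rfl⟩ := List.mem_map.1 hy
      exact hDe i k
    have hmem := ih (i :: u) (by rw [List.length_cons]; omega)
    have h1 : D i * (((i :: u).map x).prod * (b.map e).prod) -
        (((i :: u).map x).prod * (b.map e).prod) * D i ∈ W ^ (r + 1 + b.length) := by
      refine Submodule.sub_mem _ ?_ ?_
      · rw [show r + 1 + b.length = 1 + (r + b.length) by ring, pow_add, pow_one]
        exact Submodule.mul_mem_mul (hD i) hmem
      · rw [show r + 1 + b.length = (r + b.length) + 1 by ring, pow_add, pow_one]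
        exact Submodule.mul_mem_mul hmem (hD i)
    have h2 : D i * (((i :: u).map x).prod * (b.map e).prod) -
        (((i :: u).map x).prod * (b.map e).prod) * D i =
        ((u.count i : ℝ) + 1) • ((u.map x).prod * (b.map e).prod) := by
      have hx := commutator_list_prod hxx hDx i u
      have : D i * (x i * (u.map x).prod) - x i * (u.map x).prod * D i =
          (u.map x).prod + u.count i • (u.map x).prod := by
        rw [← hx, ← mul_assoc (D i), hDx i i, if_pos rfl]
        noncomm_ring
      rw [List.map_cons, List.prod_cons, mul_assoc _ (b.map e).prod (D i), ← hc.eq,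
        ← mul_assoc (D i), ← mul_assoc _ (D i), ← sub_mul, this, ← one_nsmul (u.map x).prod,
        smul_smul, ← add_smul, mul_one, add_comm, smul_mul_assoc, ← Nat.cast_smul_eq_nsmul ℝ]
      push_cast
      rw [one_nsmul]
    rw [h2] at h1
    exact (Submodule.smul_mem_iff _ (by positivity)).1 h1

/-- The space of smooth functions on `ℝ^(n+m)`. -/
def smoothFun (n m : ℕ) : Submodule ℝ (Pt n m → ℝ) where
  carrier := {f : Pt n m → ℝ | ContDiff ℝ (⊤ : ℕ∞) f}
  add_mem' {f g} hf hg := by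
    rw [Set.mem_ofPred_eq] at *
    exact hf.add hg
  zero_mem' := by
    rw [Set.mem_ofPred_eq]
    exact contDiff_const
  smul_mem' c f hf := by
    rw [Set.mem_ofPred_eq] at *
    exact hf.const_smul c

theorem mem_smoothFun {n m : ℕ} {f : Pt n m → ℝ} : f ∈ smoothFun n m ↔ ContDiff ℝ (⊤ : ℕ∞) f := by
  change f ∈ {f : Pt n m → ℝ | ContDiff ℝ (⊤ : ℕ∞) f} ↔ _
  rw [Set.mem_ofPred_eq]

theorem contDiff_coe {n m : ℕ} (f : smoothFun n m) : ContDiff ℝ (⊤ : ℕ∞) f.1 :=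
  mem_smoothFun.1 f.2

theorem differentiable_coe {n m : ℕ} (f : smoothFun n m) : Differentiable ℝ f.1 :=
  (contDiff_coe f).differentiable (by simp)

/-- The directional derivative along `v`, as an endomorphism of the smooth functions. -/
noncomputable def dirDeriv {n m : ℕ} (v : Pt n m) : Module.End ℝ (smoothFun n m) where
  toFun f := ⟨fun z => fderiv ℝ f.1 z v, mem_smoothFun.2 <|
    ((contDiff_coe f).fderiv_right (m := (⊤ : ℕ∞)) (by simp)).clm_apply contDiff_const⟩
  map_add' f g := by
    ext z
    simp [fderiv_add (differentiable_coe f z) (differentiable_coe g z)]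
  map_smul' c f := by
    ext z
    simp [fderiv_const_smul (differentiable_coe f z) c]

theorem dirDeriv_apply {n m : ℕ} (v : Pt n m) (f : smoothFun n m) (z : Pt n m) :
    (dirDeriv v f).1 z = fderiv ℝ f.1 z v := rfl

theorem commute_dirDeriv {n m : ℕ} (v w : Pt n m) : Commute (dirDeriv v) (dirDeriv w) := by
  have key (v w : Pt n m) (f : smoothFun n m) (z : Pt n m) :
      (dirDeriv v (dirDeriv w f)).1 z = fderiv ℝ (fderiv ℝ f.1) z v w := by
    have h : DifferentiableAt ℝ (fderiv ℝ f.1) z :=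
      ((contDiff_coe f).fderiv_right (m := (⊤ : ℕ∞)) (by simp)).differentiable (by simp) z
    rw [dirDeriv_apply]
    change fderiv ℝ (fun y => fderiv ℝ f.1 y w) z v = _
    rw [fderiv_clm_apply h (differentiableAt_const w)]
    simp
  refine LinearMap.ext fun f => Subtype.ext (funext fun z => ?_)
  have hsymm : IsSymmSndFDerivAt ℝ f.1 z :=
    (contDiff_coe f).contDiffAt.isSymmSndFDerivAt (by simp; norm_cast)
  exact (key v w f z).trans ((hsymm v w).trans (key w v f z).symm)

/-- Multiplication by the coordinate `x_i`, as an endomorphism of the smooth functions. -/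
noncomputable def mulCoord {n m : ℕ} (i : Fin n) : Module.End ℝ (smoothFun n m) where
  toFun f := ⟨fun z => z.1 i * f.1 z,
    mem_smoothFun.2 <| ContDiff.mul
      (((ContinuousLinearMap.proj (R := ℝ) (φ := fun _ : Fin n => ℝ) i).comp
        (ContinuousLinearMap.fst ℝ (Fin n → ℝ) (Fin m → ℝ))).contDiff) (contDiff_coe f)⟩
  map_add' f g := by
    ext z
    simp [mul_add]
  map_smul' c f := by
    ext z
    simp [mul_left_comm]

theorem mulCoord_apply {n m : ℕ} (i : Fin n) (f : smoothFun n m) (z : Pt n m) :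
    (mulCoord i f).1 z = z.1 i * f.1 z := rfl

theorem commute_mulCoord {n m : ℕ} (i j : Fin n) :
    Commute (mulCoord i : Module.End ℝ (smoothFun n m)) (mulCoord j) :=
  LinearMap.ext fun _ => Subtype.ext (funext fun _ => mul_left_comm _ _ _)

theorem dirDeriv_mul_mulCoord {n m : ℕ} (v : Pt n m) (i : Fin n) :
    dirDeriv v * mulCoord i = mulCoord i * dirDeriv v + algebraMap ℝ _ (v.1 i) := by
  refine LinearMap.ext fun f => Subtype.ext (funext fun z => ?_)
  have h : HasFDerivAt (fun z : Pt n m => z.1 i)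
      ((ContinuousLinearMap.proj i).comp (ContinuousLinearMap.fst ℝ (Fin n → ℝ) (Fin m → ℝ))) z :=
    ((ContinuousLinearMap.proj (R := ℝ) (φ := fun _ : Fin n => ℝ) i).comp
      (ContinuousLinearMap.fst ℝ (Fin n → ℝ) (Fin m → ℝ))).hasFDerivAt
  change fderiv ℝ (fun z => z.1 i * f.1 z) z v = z.1 i * fderiv ℝ f.1 z v + v.1 i * f.1 z
  have h' : fderiv ℝ (fun z => z.1 i * f.1 z) z = _ :=
    (h.mul (differentiable_coe f z).hasFDerivAt).fderiv
  rw [h']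
  simp [mul_comm]

/-- `∂_{x_j}` on smooth functions. -/
noncomputable abbrev smoothDx {n m : ℕ} (j : Fin n) : Module.End ℝ (smoothFun n m) :=
  dirDeriv (Pi.single j 1, 0)

/-- `∂_{y_k}` on smooth functions. -/
noncomputable abbrev smoothDy {n m : ℕ} (k : Fin m) : Module.End ℝ (smoothFun n m) :=
  dirDeriv (0, Pi.single k 1)

theorem list_prod_mulCoord_apply {n m : ℕ} (u : List (Fin n)) (f : smoothFun n m) (z : Pt n m) :
    (((u.map mulCoord).prod : Module.End ℝ (smoothFun n m)) f).1 z = (u.map z.1).prod * f.1 z := by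
  induction u with
  | nil => simp
  | cons i u ih =>
    rw [List.map_cons, List.prod_cons, List.map_cons, List.prod_cons, Module.End.mul_apply,
      mulCoord_apply, ih, mul_assoc]

/-- The operators of the family `𝒳`, acting on smooth functions. -/
noncomputable def smoothX (n m N : ℕ) : XIdx n m N → Module.End ℝ (smoothFun n m)
  | Sum.inl j => smoothDx j
  | Sum.inr (ν, k) =>
      Real.sqrt ((Nat.factorial N : ℝ) / ∏ i, (Nat.factorial (ν.1 i) : ℝ)) •
        ((((List.finRange n).flatMap fun i => List.replicate (ν.1 i) i).map mulCoord).prod *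
          smoothDy k)

theorem prod_map_flatMap_replicate {n : ℕ} (ν : Fin n → ℕ) (x : Fin n → ℝ) :
    (((List.finRange n).flatMap fun i => List.replicate (ν i) i).map x).prod =
      ∏ i, x i ^ ν i := by
  rw [List.map_flatMap, List.flatMap_def, List.prod_flatten, List.map_map, ← List.ofFn_eq_map,
    List.prod_ofFn]
  simp

theorem smoothX_apply {n m N : ℕ} (a : XIdx n m N) (f : smoothFun n m) :
    (smoothX n m N a f).1 = Xop n m N a f.1 := by
  rcases a with j | ⟨ν, k⟩
  · rfl
  · funext z
    change Real.sqrt _ * (((List.map mulCoord _).prod : Module.End ℝ (smoothFun n m))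
      (smoothDy k f)).1 z = Real.sqrt _ * _ * _
    rw [list_prod_mulCoord_apply, prod_map_flatMap_replicate, mul_assoc]
    rfl

theorem list_prod_smoothX_apply {n m N : ℕ} (l : List (XIdx n m N)) (f : smoothFun n m) :
    ((l.map (smoothX n m N)).prod f).1 = compOps (l.map (Xop n m N)) f.1 := by
  induction l with
  | nil => rfl
  | cons a l ih =>
    rw [List.map_cons, List.prod_cons, Module.End.mul_apply, smoothX_apply, ih]
    rfl

/-- The span of the operators of the family `𝒳`. -/
noncomputable def spanX (n m N : ℕ) : Submodule ℝ (Module.End ℝ (smoothFun n m)) :=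
  Submodule.span ℝ (Set.range (smoothX n m N))

theorem mulCoord_prod_mul_smoothDy_mem {n m N : ℕ} (u : List (Fin n)) (hu : u.length = N)
    (k : Fin m) : (u.map mulCoord).prod * smoothDy k ∈ spanX n m N := by
  have hν : ∑ i, u.count i = N := by
    rw [← hu]
    simpa using Multiset.sum_count_eq_card (s := Finset.univ) (m := (u : Multiset (Fin n)))
      (by simp)
  have hX : smoothX n m N (Sum.inr (⟨fun i => u.count i, hν⟩, k)) ∈ spanX n m N :=
    Submodule.subset_span ⟨_, rfl⟩
  have hperm : ((List.finRange n).flatMap fun i => List.replicate (u.count i) i).Perm u := by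
    rw [List.perm_iff_count]
    intro i
    rw [List.count_flatMap, ← List.ofFn_eq_map, List.sum_ofFn]
    simp [List.count_replicate]
  have hprod : (((List.finRange n).flatMap fun i => List.replicate (u.count i) i).map
      mulCoord).prod = ((u.map mulCoord).prod : Module.End ℝ (smoothFun n m)) := by
    refine (hperm.map mulCoord).prod_eq' ?_
    refine List.Pairwise.imp_of_mem (R := fun _ _ => True) (fun {a b} ha hb _ => ?_)
      (List.pairwise_of_forall fun _ _ => trivial)
    obtain ⟨i, -, rfl⟩ := List.mem_map.1 ha
    obtain ⟨j, -, rfl⟩ := List.mem_map.1 hb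
    exact commute_mulCoord i j
  rw [← hprod]
  refine (Submodule.smul_mem_iff _ ?_).1 hX
  positivity

theorem mem_spanX_pow {n m N : ℕ} (hn : 0 < n) (r : ℕ) (u : List (Fin n)) (b : List (Fin m))
    (a : List (Fin n)) (h : u.length + r = N * b.length) :
    (u.map mulCoord).prod * ((b.map smoothDy).prod * (a.map smoothDx).prod) ∈
      spanX n m N ^ (r + b.length + a.length) := by
  have : Nonempty (Fin n) := ⟨⟨0, hn⟩⟩
  have hD (i : Fin n) : (smoothDx i : Module.End ℝ (smoothFun n m)) ∈ spanX n m N :=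
    Submodule.subset_span ⟨Sum.inl i, rfl⟩
  rw [← mul_assoc, pow_add]
  refine Submodule.mul_mem_mul (list_prod_mul_list_prod_mem_pow (D := smoothDx) commute_mulCoord
    (fun i k => ?_) (fun i k => commute_dirDeriv _ _) (fun i j => ?_) hD
    mulCoord_prod_mul_smoothDy_mem r u b h) ?_
  · have h := dirDeriv_mul_mulCoord ((0, Pi.single k 1) : Pt n m) i
    rw [show ((0, Pi.single k 1) : Pt n m).1 i = 0 from rfl, map_zero, add_zero] at h
    exact h.symm
  · rw [dirDeriv_mul_mulCoord]
    by_cases hij : i = j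
    · simp [hij]
    · simp [hij, Ne.symm hij]
  · clear h
    induction a with
    | nil =>
      rw [List.length_nil, pow_zero]
      exact Submodule.one_le.1 le_rfl
    | cons i a ih =>
      rw [List.map_cons, List.prod_cons, List.length_cons, pow_succ']
      exact Submodule.mul_mem_mul (hD i) ih

theorem exists_eLpNorm_le_of_mem_spanX_pow {n m N M : ℕ} {T : Module.End ℝ (smoothFun n m)}
    (hT : T ∈ spanX n m N ^ M) {p : ℝ≥0∞} (hp : 1 ≤ p) :
    ∃ C : ℝ≥0, ∀ f : smoothFun n m, eLpNorm (T f).1 p volume ≤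
      C * ⨆ β : Fin M → XIdx n m N, eLpNorm (Xw β f.1) p volume := by
  rw [spanX, Submodule.span_pow] at hT
  induction hT using Submodule.span_induction with
  | mem T hT =>
    obtain ⟨t, rfl⟩ := Set.mem_pow.1 hT
    choose β hβ using fun i => (t i).2
    refine ⟨1, fun f => ?_⟩
    have h : ((List.ofFn fun i => (t i : Module.End ℝ (smoothFun n m))).prod f).1 = Xw β f.1 := by
      have hlist : (List.ofFn fun i => (t i : Module.End ℝ (smoothFun n m))) =
          (List.ofFn β).map (smoothX n m N) := by
        rw [List.map_ofFn]
        exact congrArg _ (funext fun i => (hβ i).symm)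
      rw [hlist, list_prod_smoothX_apply, List.map_ofFn]
      rfl
    rw [h, ENNReal.coe_one, one_mul]
    exact le_iSup (fun β : Fin M → XIdx n m N => eLpNorm (Xw β f.1) p volume) β
  | zero => exact ⟨0, fun f => by simp⟩
  | add S T _ _ hS hT =>
    obtain ⟨C, hC⟩ := hS
    obtain ⟨C', hC'⟩ := hT
    refine ⟨C + C', fun f => ?_⟩
    rw [ENNReal.coe_add, add_mul]
    exact (eLpNorm_add_le (contDiff_coe (S f)).continuous.aestronglyMeasurable
      (contDiff_coe (T f)).continuous.aestronglyMeasurable hp).trans (add_le_add (hC f) (hC' f))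
  | smul c T _ hT =>
    obtain ⟨C, hC⟩ := hT
    refine ⟨‖c‖₊ * C, fun f => ?_⟩
    rw [ENNReal.coe_mul, mul_assoc]
    refine (eLpNorm_const_smul_le (c := c) (f := (T f).1)).trans ?_
    gcongr
    · exact le_rfl
    · exact hC f

theorem rpow_sub_one_mul_le {p a t δ : ℝ} (hp : 1 < p) (ha : 0 ≤ a) (ht : 0 ≤ t) (hδ : 0 < δ) :
    a ^ (p - 1) * t ≤ δ * a ^ p + δ ^ (1 - p) * t ^ p := by
  rcases le_total t (δ * a) with h | h
  · calc a ^ (p - 1) * t ≤ a ^ (p - 1) * (δ * a) := by gcongr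
      _ = δ * a ^ p := by
        rcases ha.eq_or_lt with rfl | ha
        · rw [Real.zero_rpow (by linarith : p ≠ 0)]; ring
        · rw [Real.rpow_sub_one ha.ne']; field_simp
      _ ≤ _ := le_add_of_nonneg_right (by positivity)
  · have h' : a ≤ t / δ := by rw [le_div_iff₀ hδ]; linarith
    calc a ^ (p - 1) * t ≤ (t / δ) ^ (p - 1) * t := by
          gcongr
      _ = δ ^ (1 - p) * t ^ p := by
        rw [Real.div_rpow ht hδ.le, show (1 - p) = -(p - 1) by ring, Real.rpow_neg hδ.le]
        rcases ht.eq_or_lt with rfl | ht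
        · rw [Real.zero_rpow (by linarith : p ≠ 0)]; ring
        · rw [Real.rpow_sub_one ht.ne']; field_simp
      _ ≤ _ := le_add_of_nonneg_left (by positivity)

/-- The Euclidean norm on `Fin n → ℝ`. -/
noncomputable def eucl {n : ℕ} (x : Fin n → ℝ) : ℝ := Real.sqrt (∑ i, x i ^ 2)

theorem eucl_nonneg {n : ℕ} (x : Fin n → ℝ) : 0 ≤ eucl x := Real.sqrt_nonneg _

theorem eucl_sq {n : ℕ} (x : Fin n → ℝ) : eucl x ^ 2 = ∑ i, x i ^ 2 :=
  Real.sq_sqrt (Finset.sum_nonneg fun _ _ => sq_nonneg _)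

theorem abs_le_eucl {n : ℕ} (x : Fin n → ℝ) (i : Fin n) : |x i| ≤ eucl x :=
  Real.abs_le_sqrt (Finset.single_le_sum (f := fun i => x i ^ 2) (fun _ _ => sq_nonneg _)
    (Finset.mem_univ i))

theorem eucl_pos {n : ℕ} {x : Fin n → ℝ} (hx : x ≠ 0) : 0 < eucl x := by
  obtain ⟨i, hi⟩ := Function.ne_iff.1 hx
  exact (abs_pos.2 hi).trans_le (abs_le_eucl x i)

theorem continuous_eucl {n : ℕ} : Continuous (eucl : (Fin n → ℝ) → ℝ) := by
  unfold eucl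
  fun_prop

theorem ae_fst_ne_zero {n m : ℕ} (hn : 0 < n) : ∀ᵐ z : Pt n m, z.1 ≠ 0 := by
  have : Nonempty (Fin n) := ⟨⟨0, hn⟩⟩
  have h : ∀ᵐ x : Fin n → ℝ, x ≠ 0 := by
    rw [ae_iff]
    simp
  exact Measure.quasiMeasurePreserving_fst.ae h

theorem integral_fderiv_apply_eq_zero {n m : ℕ} {f : Pt n m → ℝ} (hf : ContDiff ℝ 1 f)
    (hc : HasCompactSupport f) (v : Pt n m) : ∫ z, fderiv ℝ f z v = 0 := by
  have : (volume : Measure (Pt n m)).IsAddHaarMeasure := Measure.prod.instIsAddHaarMeasure _ _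
  have hd : Continuous fun z => fderiv ℝ f z v := (hf.continuous_fderiv (by simp)).clm_apply
    continuous_const
  have hi := hd.integrable_of_hasCompactSupport (μ := volume) (hc.fderiv_apply ℝ v)
  have h := integral_mul_fderiv_eq_neg_fderiv_mul_of_integrable (μ := volume) (v := v)
    (f := fun _ : Pt n m => (1 : ℝ)) (g := f) (by simp) (by simpa using hi)
    (by simpa using hf.continuous.integrable_of_hasCompactSupport hc)
    (fun z _ => differentiableAt_const _) (fun z _ => hf.differentiable (by simp) z)
  simpa using h

/-- The regularised weight `(|x|² + ε)^s`. -/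
noncomputable def regWeight (n m : ℕ) (ε s : ℝ) (z : Pt n m) : ℝ := (∑ i, z.1 i ^ 2 + ε) ^ s

theorem sum_sq_add_pos {n m : ℕ} {ε : ℝ} (hε : 0 < ε) (z : Pt n m) : 0 < ∑ i, z.1 i ^ 2 + ε :=
  add_pos_of_nonneg_of_pos (Finset.sum_nonneg fun _ _ => sq_nonneg _) hε

theorem contDiff_regWeight {n m : ℕ} {ε : ℝ} (hε : 0 < ε) (s : ℝ) :
    ContDiff ℝ 1 (regWeight n m ε s) := by
  unfold regWeight
  exact ContDiff.rpow_const_of_ne (by fun_prop) fun z => (sum_sq_add_pos hε z).ne'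

theorem fderiv_regWeight {n m : ℕ} {ε : ℝ} (hε : 0 < ε) (s : ℝ) (z : Pt n m) (i : Fin n) :
    fderiv ℝ (regWeight n m ε s) z (Pi.single i 1, 0) =
      2 * s * z.1 i * (∑ i, z.1 i ^ 2 + ε) ^ (s - 1) := by
  have hc (j : Fin n) : HasFDerivAt (fun z : Pt n m => z.1 j)
      ((ContinuousLinearMap.proj j).comp (ContinuousLinearMap.fst ℝ (Fin n → ℝ) (Fin m → ℝ))) z :=
    ((ContinuousLinearMap.proj (R := ℝ) (φ := fun _ : Fin n => ℝ) j).comp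
      (ContinuousLinearMap.fst ℝ (Fin n → ℝ) (Fin m → ℝ))).hasFDerivAt
  have h := ((HasFDerivAt.fun_sum (u := Finset.univ) fun j _ => (hc j).pow 2).add_const ε).rpow_const
    (p := s) (Or.inl (sum_sq_add_pos hε z).ne')
  have h' : fderiv ℝ (regWeight n m ε s) z = _ := h.fderiv
  rw [h']
  simp [Pi.single_apply]
  ring

theorem fderiv_abs_rpow {n m : ℕ} {g : Pt n m → ℝ} (hg : Differentiable ℝ g) {p : ℝ} (hp : 1 < p)
    (z v : Pt n m) :
    fderiv ℝ (fun z => |g z| ^ p) z v = p * |g z| ^ (p - 2) * g z * fderiv ℝ g z v := by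
  have h := (hasDerivAt_abs_rpow (g z) hp).comp_hasFDerivAt z (hg z).hasFDerivAt
  have h' : fderiv ℝ (fun z => |g z| ^ p) z = _ := h.fderiv
  rw [h']
  simp

theorem integral_regWeight_mul_le {n m : ℕ} {p q ε : ℝ} (hp : 1 < p) (hq : 0 < q) (hqn : q < n)
    (hε : 0 < ε) {g : Pt n m → ℝ} (hg : ContDiff ℝ 1 g) (hc : HasCompactSupport g) :
    (n - q) / 2 * ∫ z, regWeight n m ε (-q / 2) z * |g z| ^ p ≤
      p * ((n - q) / (2 * p)) ^ (1 - p) *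
        ∫ z, regWeight n m ε (-q / 2) z * (eucl z.1 * ∑ i, |Dx n m i g z|) ^ p := by
  set δ : ℝ := (n - q) / (2 * p) with hδdef
  have hδ : 0 < δ := div_pos (by linarith) (by linarith)
  set w := regWeight n m ε (-q / 2) with hw
  have hwC : ContDiff ℝ 1 w := contDiff_regWeight hε _
  have hw0 (z) : 0 ≤ w z := Real.rpow_nonneg (sum_sq_add_pos hε z).le _
  have hG : ContDiff ℝ 1 fun z => |g z| ^ p := (contDiff_norm_rpow hp).comp hg
  have hGc : HasCompactSupport fun z => |g z| ^ p :=
    hc.comp_left (g := fun t : ℝ => |t| ^ p)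
      (by rw [abs_zero, Real.zero_rpow (by linarith : p ≠ 0)])
  have hx (i : Fin n) : ContDiff ℝ 1 fun z : Pt n m => z.1 i := by fun_prop
  let H (i : Fin n) (z : Pt n m) : ℝ := z.1 i * (w z * |g z| ^ p)
  have hH (i : Fin n) : ContDiff ℝ 1 (H i) := (hx i).mul (hwC.mul hG)
  have hHc (i : Fin n) : HasCompactSupport (H i) := (hGc.mul_left).mul_left
  have hHd (i : Fin n) (z : Pt n m) : fderiv ℝ (H i) z (Pi.single i 1, 0) =
      w z * |g z| ^ p - q * (z.1 i ^ 2 * (∑ i, z.1 i ^ 2 + ε) ^ (-q / 2 - 1)) * |g z| ^ p +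
        p * w z * |g z| ^ (p - 2) * g z * (z.1 i * Dx n m i g z) := by
    have h1 : fderiv ℝ (H i) z = _ := fderiv_mul ((hx i).differentiable (by simp) z)
      ((hwC.mul hG).differentiable (by simp) z)
    have h2 : fderiv ℝ (fun z => w z * |g z| ^ p) z = _ := fderiv_mul
      (hwC.differentiable (by simp) z) (hG.differentiable (by simp) z)
    have h3 : fderiv ℝ (fun z : Pt n m => z.1 i) z (Pi.single i 1, 0) = 1 := by
      have : fderiv ℝ (fun z : Pt n m => z.1 i) z = _ :=
        ((ContinuousLinearMap.proj (R := ℝ) (φ := fun _ : Fin n => ℝ) i).comp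
          (ContinuousLinearMap.fst ℝ (Fin n → ℝ) (Fin m → ℝ))).hasFDerivAt.fderiv
      rw [this]
      simp
    rw [h1]
    change z.1 i * fderiv ℝ (fun z => w z * |g z| ^ p) z (Pi.single i 1, 0) +
      (w z * |g z| ^ p) * fderiv ℝ (fun z : Pt n m => z.1 i) z (Pi.single i 1, 0) = _
    rw [h2, h3]
    change z.1 i * (w z * fderiv ℝ (fun z => |g z| ^ p) z (Pi.single i 1, 0) +
      |g z| ^ p * fderiv ℝ w z (Pi.single i 1, 0)) + _ = _
    rw [fderiv_abs_rpow (hg.differentiable (by simp)) hp, fderiv_regWeight hε, Dx]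
    ring
  have hpt (z : Pt n m) : (n - q) / 2 * (w z * |g z| ^ p) -
      p * δ ^ (1 - p) * (w z * (eucl z.1 * ∑ i, |Dx n m i g z|) ^ p) ≤
        ∑ i, fderiv ℝ (H i) z (Pi.single i 1, 0) := by
    have hsum : ∑ i, fderiv ℝ (H i) z (Pi.single i 1, 0) =
        n * (w z * |g z| ^ p) -
          q * ((∑ i, z.1 i ^ 2) * (∑ i, z.1 i ^ 2 + ε) ^ (-q / 2 - 1)) * |g z| ^ p +
        p * w z * (|g z| ^ (p - 2) * g z * ∑ i, z.1 i * Dx n m i g z) := by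
      simp only [hHd, Finset.sum_add_distrib, Finset.sum_sub_distrib, ← Finset.mul_sum,
        ← Finset.sum_mul, Finset.sum_const, Finset.card_univ, Fintype.card_fin, nsmul_eq_mul]
      ring
    have hw1 : (∑ i, z.1 i ^ 2) * (∑ i, z.1 i ^ 2 + ε) ^ (-q / 2 - 1) ≤ w z := by
      rw [Real.rpow_sub_one (sum_sq_add_pos hε z).ne', mul_div_assoc', div_le_iff₀
        (sum_sq_add_pos hε z), mul_comm]
      exact mul_le_mul_of_nonneg_left (by linarith) (hw0 z)
    have hV : |∑ i, z.1 i * Dx n m i g z| ≤ eucl z.1 * ∑ i, |Dx n m i g z| := by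
      rw [Finset.mul_sum]
      refine (Finset.abs_sum_le_sum_abs _ _).trans (Finset.sum_le_sum fun i _ => ?_)
      rw [abs_mul]
      exact mul_le_mul_of_nonneg_right (abs_le_eucl _ _) (abs_nonneg _)
    have hpow : |g z| ^ (p - 2) * |g z| = |g z| ^ (p - 1) := by
      rcases (abs_nonneg (g z)).eq_or_lt with h | h
      · rw [← h, Real.zero_rpow (by linarith : p - 1 ≠ 0), mul_zero]
      · rw [← Real.rpow_add_one h.ne']
        ring_nf
    have hY := rpow_sub_one_mul_le hp (abs_nonneg (g z))
      (mul_nonneg (eucl_nonneg z.1) (Finset.sum_nonneg (s := Finset.univ)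
        fun i _ => abs_nonneg (Dx n m i g z))) hδ
    have hT : -(δ * |g z| ^ p + δ ^ (1 - p) * (eucl z.1 * ∑ i, |Dx n m i g z|) ^ p) ≤
        |g z| ^ (p - 2) * g z * ∑ i, z.1 i * Dx n m i g z := by
      refine neg_le_of_abs_le (le_trans ?_ hY)
      rw [abs_mul, abs_mul, abs_of_nonneg (Real.rpow_nonneg (abs_nonneg (g z)) _), hpow]
      exact mul_le_mul_of_nonneg_left hV (Real.rpow_nonneg (abs_nonneg _) _)
    have hT' := mul_le_mul_of_nonneg_left hT (mul_nonneg (by linarith : 0 ≤ p) (hw0 z))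
    have hw1' := mul_le_mul_of_nonneg_right (mul_le_mul_of_nonneg_left hw1 hq.le)
      (Real.rpow_nonneg (abs_nonneg (g z)) p)
    have hpδ : p * δ = (n - q) / 2 := by
      rw [hδdef]
      field_simp
    rw [hsum]
    have e1 : p * w z * -(δ * |g z| ^ p + δ ^ (1 - p) * (eucl z.1 * ∑ i, |Dx n m i g z|) ^ p) =
      -((p * δ) * (w z * |g z| ^ p)) -
        p * δ ^ (1 - p) * (w z * (eucl z.1 * ∑ i, |Dx n m i g z|) ^ p) := by ring
    rw [e1, hpδ] at hT'
    linarith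
  have hi1 : Integrable (fun z => w z * |g z| ^ p) (volume : Measure (Pt n m)) :=
    (hwC.continuous.mul hG.continuous).integrable_of_hasCompactSupport hGc.mul_left
  have hDc (i : Fin n) : Continuous (Dx n m i g) :=
    (hg.continuous_fderiv (by simp)).clm_apply continuous_const
  have hi2 : Integrable (fun z => w z * (eucl z.1 * ∑ i, |Dx n m i g z|) ^ p)
      (volume : Measure (Pt n m)) := by
    have hcont : Continuous fun z => w z * (eucl z.1 * ∑ i, |Dx n m i g z|) ^ p :=
      hwC.continuous.mul (((continuous_eucl.comp continuous_fst).mul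
        (continuous_finsetSum _ fun i _ => (hDc i).abs)).rpow_const
          fun z => Or.inr (by linarith))
    refine hcont.integrable_of_hasCompactSupport ((hc.fderiv (𝕜 := ℝ)).mono' ?_)
    refine Function.support_subset_iff'.2 fun z hz => ?_
    have h0 : fderiv ℝ g z = 0 := image_eq_zero_of_notMem_tsupport hz
    simp [Dx, h0, Real.zero_rpow (by linarith : p ≠ 0)]
  have hi3 (i : Fin n) : Integrable (fun z => fderiv ℝ (H i) z (Pi.single i 1, 0))
      (volume : Measure (Pt n m)) :=
    (((hH i).continuous_fderiv (by simp)).clm_apply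
      continuous_const).integrable_of_hasCompactSupport ((hHc i).fderiv_apply ℝ _)
  have hmono := integral_mono ((hi1.const_mul ((n - q) / 2)).sub
    (hi2.const_mul (p * δ ^ (1 - p)))) (integrable_finsetSum _ fun i _ => hi3 i) hpt
  rw [integral_finsetSum _ fun i _ => hi3 i] at hmono
  simp only [integral_fderiv_apply_eq_zero (hH _) (hHc _), Finset.sum_const_zero] at hmono
  rw [integral_sub' (hi1.const_mul _) (hi2.const_mul _), integral_const_mul,
    integral_const_mul] at hmono
  linarith

/-- A weighted Hardy inequality in the `x` variables. -/
theorem eLpNorm_eucl_rpow_mul_le {n m : ℕ} {p κ : ℝ} (hp : 1 < p) (hκ : 0 < κ) (hκn : κ * p < n) :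
    ∃ C : ℝ≥0, ∀ g : Pt n m → ℝ, ContDiff ℝ 1 g → HasCompactSupport g →
      eLpNorm (fun z => eucl z.1 ^ (-κ) * g z) (ENNReal.ofReal p) volume ≤
        C * eLpNorm (fun z => eucl z.1 ^ (1 - κ) * ∑ i, |Dx n m i g z|)
          (ENNReal.ofReal p) volume := by
  have hp0 : 0 < p := by linarith
  have hn : 0 < n := by
    have : (0 : ℝ) < n := (mul_pos hκ hp0).trans hκn
    exact_mod_cast this
  set q := κ * p with hq
  have hc : 0 < (n - q) / 2 := by linarith
  set K : ℝ := p * ((n - q) / (2 * p)) ^ (1 - p) / ((n - q) / 2) with hK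
  have hK0 : 0 ≤ K := by
    have : 0 ≤ (n - q) / (2 * p) := div_nonneg (by linarith) (by linarith)
    positivity
  have hpt : ENNReal.ofReal p ≠ ∞ := ENNReal.ofReal_ne_top
  have hpz : ENNReal.ofReal p ≠ 0 := by simpa using hp0
  refine ⟨(K ^ (1 / p)).toNNReal, fun g hg hgc => ?_⟩
  set S : Pt n m → ℝ := fun z => ∑ i, |Dx n m i g z| with hS
  have hS0 (z) : 0 ≤ S z := Finset.sum_nonneg fun i _ => abs_nonneg _
  have hreg (ε : ℝ) (hε : 0 < ε) :
      eLpNorm (fun z => regWeight n m ε (-κ / 2) z * g z) (ENNReal.ofReal p) volume ≤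
        (K ^ (1 / p)).toNNReal *
          eLpNorm (fun z => eucl z.1 ^ (1 - κ) * S z) (ENNReal.ofReal p) volume := by
    have hw0 (s : ℝ) (z) : 0 ≤ regWeight n m ε s z :=
      Real.rpow_nonneg (sum_sq_add_pos hε z).le _
    have hwp (z) : regWeight n m ε (-κ / 2) z ^ p = regWeight n m ε (-q / 2) z := by
      rw [regWeight, regWeight, ← Real.rpow_mul (sum_sq_add_pos hε z).le, hq]
      congr 1
      ring
    have hI := integral_regWeight_mul_le hp (mul_pos hκ hp0) hκn hε hg hgc
    have hI' : ∫ z, regWeight n m ε (-q / 2) z * |g z| ^ p ≤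
        K * ∫ z, regWeight n m ε (-q / 2) z * (eucl z.1 * S z) ^ p := by
      rw [hK, div_mul_eq_mul_div, le_div_iff₀ hc, mul_comm]
      exact hI
    have hint1 : Integrable (fun z => regWeight n m ε (-q / 2) z * |g z| ^ p)
        (volume : Measure (Pt n m)) := by
      refine ((contDiff_regWeight hε _).continuous.mul
        (hg.continuous.abs.rpow_const fun z => Or.inr hp0.le)).integrable_of_hasCompactSupport
          (HasCompactSupport.mul_left ?_)
      exact hgc.comp_left (g := fun t : ℝ => |t| ^ p)
        (by rw [abs_zero, Real.zero_rpow hp0.ne'])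
    have hle : ∫⁻ z, ‖regWeight n m ε (-κ / 2) z * g z‖ₑ ^ p ≤
        ENNReal.ofReal K * ∫⁻ z, ‖eucl z.1 ^ (1 - κ) * S z‖ₑ ^ p := by
      calc ∫⁻ z, ‖regWeight n m ε (-κ / 2) z * g z‖ₑ ^ p
          = ∫⁻ z, ENNReal.ofReal (regWeight n m ε (-q / 2) z * |g z| ^ p) := by
            refine lintegral_congr fun z => ?_
            rw [Real.enorm_eq_ofReal_abs, ENNReal.ofReal_rpow_of_nonneg (abs_nonneg _) hp0.le,
              abs_mul, abs_of_nonneg (hw0 _ _), Real.mul_rpow (hw0 _ _) (abs_nonneg _), hwp]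
        _ = ENNReal.ofReal (∫ z, regWeight n m ε (-q / 2) z * |g z| ^ p) :=
            (ofReal_integral_eq_lintegral_ofReal hint1 (Filter.Eventually.of_forall fun z =>
              mul_nonneg (hw0 _ _) (Real.rpow_nonneg (abs_nonneg _) _))).symm
        _ ≤ ENNReal.ofReal (K * ∫ z, regWeight n m ε (-q / 2) z * (eucl z.1 * S z) ^ p) :=
            ENNReal.ofReal_le_ofReal hI'
        _ ≤ ENNReal.ofReal K *
              ∫⁻ z, ENNReal.ofReal (regWeight n m ε (-q / 2) z * (eucl z.1 * S z) ^ p) := by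
            rw [ENNReal.ofReal_mul hK0]
            gcongr
            by_cases h : Integrable (fun z => regWeight n m ε (-q / 2) z * (eucl z.1 * S z) ^ p)
                (volume : Measure (Pt n m))
            · exact (ofReal_integral_eq_lintegral_ofReal h (Filter.Eventually.of_forall fun z =>
                mul_nonneg (hw0 _ _)
                  (Real.rpow_nonneg (mul_nonneg (eucl_nonneg _) (hS0 z)) _))).le
            · simp [integral_undef h]
        _ ≤ _ := by
            gcongr ENNReal.ofReal K * ?_
            refine lintegral_mono_ae ((ae_fst_ne_zero hn).mono fun z hz => ?_)
            have hr := eucl_pos hz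
            rw [Real.enorm_eq_ofReal_abs, ENNReal.ofReal_rpow_of_nonneg (abs_nonneg _) hp0.le,
              abs_of_nonneg (mul_nonneg (Real.rpow_nonneg hr.le _) (hS0 z)), ← hwp,
              ← Real.mul_rpow (hw0 _ _) (mul_nonneg hr.le (hS0 z)), ← mul_assoc]
            refine ENNReal.ofReal_le_ofReal (Real.rpow_le_rpow
              (mul_nonneg (mul_nonneg (hw0 _ _) hr.le) (hS0 z)) ?_ hp0.le)
            refine mul_le_mul_of_nonneg_right ?_ (hS0 z)
            rw [show 1 - κ = -κ + 1 by ring, Real.rpow_add_one hr.ne']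
            refine mul_le_mul_of_nonneg_right ?_ hr.le
            have h2 : eucl z.1 ^ (-κ) = (eucl z.1 ^ 2) ^ (-κ / 2) := by
              rw [← Real.rpow_natCast, ← Real.rpow_mul hr.le]
              congr 1
              push_cast
              ring
            rw [h2, regWeight, eucl_sq]
            refine Real.rpow_le_rpow_of_nonpos ?_ (by linarith) (by linarith)
            rw [← eucl_sq]
            positivity
    have hpr : (ENNReal.ofReal p).toReal = p := ENNReal.toReal_ofReal hp0.le
    rw [eLpNorm_eq_lintegral_rpow_enorm_toReal hpz hpt,
      eLpNorm_eq_lintegral_rpow_enorm_toReal hpz hpt, hpr]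
    refine (ENNReal.rpow_le_rpow hle (by positivity)).trans_eq ?_
    rw [ENNReal.mul_rpow_of_nonneg _ _ (by positivity), ENNReal.ofReal_rpow_of_nonneg hK0
      (by positivity)]
    rfl
  let ε (k : ℕ) : ℝ := 1 / ((k : ℝ) + 1)
  have hε (k) : 0 < ε k := Nat.one_div_pos_of_nat
  refine (Lp.eLpNorm_lim_le_liminf_eLpNorm (f := fun k z => regWeight n m (ε k) (-κ / 2) z * g z)
    (fun k => ((contDiff_regWeight (hε k) _).continuous.mul
      hg.continuous).aestronglyMeasurable) _ ?_).trans ?_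
  · filter_upwards [ae_fst_ne_zero hn] with z hz
    have hr := eucl_pos hz
    have h2 : eucl z.1 ^ (-κ) = (eucl z.1 ^ 2 + 0) ^ (-κ / 2) := by
      rw [add_zero, ← Real.rpow_natCast, ← Real.rpow_mul hr.le]
      congr 1
      push_cast
      ring
    rw [h2]
    refine Filter.Tendsto.mul_const _ ?_
    simp only [regWeight, ← eucl_sq]
    exact (tendsto_one_div_add_atTop_nhds_zero_nat.const_add _).rpow_const
      (Or.inl (by positivity))
  · exact Filter.liminf_le_of_frequently_le'
      (Filter.Frequently.of_forall fun k => hreg (ε k) (hε k))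

/-- Functions on `ℝⁿ` that are smooth away from the origin and homogeneous of degree `d` there. -/
structure IsHomog {n : ℕ} (d : ℤ) (c : (Fin n → ℝ) → ℝ) : Prop where
  contDiffAt : ∀ x ≠ 0, ContDiffAt ℝ (⊤ : ℕ∞) c x
  map_smul : ∀ t > 0, ∀ x ≠ 0, c (t • x) = t ^ d * c x

theorem eucl_smul {n : ℕ} {t : ℝ} (ht : 0 ≤ t) (x : Fin n → ℝ) : eucl (t • x) = t * eucl x := by
  have h : ∑ i, (t • x) i ^ 2 = t ^ 2 * ∑ i, x i ^ 2 := by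
    simp [Finset.mul_sum, mul_pow]
  rw [eucl, h, Real.sqrt_mul (sq_nonneg t), Real.sqrt_sq ht, eucl]

theorem isHomog_eucl_pow {n : ℕ} (N : ℕ) : IsHomog (n := n) N fun x => eucl x ^ N where
  contDiffAt x hx := by
    refine ContDiffAt.pow ?_ N
    refine ContDiffAt.sqrt (by fun_prop) ?_
    rw [← eucl_sq]
    exact (pow_pos (eucl_pos hx) 2).ne'
  map_smul t ht x _ := by
    rw [eucl_smul ht.le, mul_pow, zpow_natCast]

theorem IsHomog.mul {n : ℕ} {d e : ℤ} {b c : (Fin n → ℝ) → ℝ} (hb : IsHomog d b)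
    (hc : IsHomog e c) : IsHomog (d + e) fun x => b x * c x where
  contDiffAt x hx := (hb.contDiffAt x hx).mul (hc.contDiffAt x hx)
  map_smul t ht x hx := by
    rw [hb.map_smul t ht x hx, hc.map_smul t ht x hx, zpow_add₀ ht.ne']
    ring

theorem IsHomog.fderiv_apply {n : ℕ} {d : ℤ} {c : (Fin n → ℝ) → ℝ} (hc : IsHomog d c)
    (v : Fin n → ℝ) : IsHomog (d - 1) fun x => fderiv ℝ c x v where
  contDiffAt x hx :=
    ((hc.contDiffAt x hx).fderiv_right (m := (⊤ : ℕ∞)) (by simp)).clm_apply contDiffAt_const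
  map_smul t ht x hx := by
    have h : (fun y => c (t • y)) =ᶠ[nhds x] fun y => t ^ d * c y := by
      filter_upwards [isOpen_ne.mem_nhds hx] with y hy
      exact hc.map_smul t ht y hy
    have h1 := h.fderiv_eq (𝕜 := ℝ)
    rw [fderiv_comp_smul, fderiv_const_mul ((hc.contDiffAt x hx).differentiableAt (by simp))] at h1
    have h2 := congrArg (fun L => L v) h1
    simp only [smul_apply, smul_eq_mul] at h2
    rw [zpow_sub_one₀ ht.ne', mul_right_comm, ← h2]
    field_simp

theorem IsHomog.exists_abs_le {n : ℕ} {d : ℤ} {c : (Fin n → ℝ) → ℝ} (hc : IsHomog d c) :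
    ∃ C : ℝ≥0, ∀ x ≠ 0, |c x| ≤ C * eucl x ^ d := by
  have hK : IsCompact {x : Fin n → ℝ | eucl x = 1} := by
    refine Metric.isCompact_of_isClosed_isBounded
      (isClosed_eq continuous_eucl continuous_const) ?_
    refine (Metric.isBounded_closedBall (x := (0 : Fin n → ℝ)) (r := 1)).subset fun x hx => ?_
    rw [Set.mem_ofPred_eq] at hx
    rw [mem_closedBall_zero_iff, pi_norm_le_iff_of_nonneg zero_le_one]
    intro i
    rw [← hx]
    exact abs_le_eucl x i
  have hcont : ContinuousOn c {x : Fin n → ℝ | eucl x = 1} := fun x hx => by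
    rw [Set.mem_ofPred_eq] at hx
    refine (hc.contDiffAt x ?_).continuousAt.continuousWithinAt
    rintro rfl
    simp [eucl] at hx
  obtain ⟨C, hC⟩ := hK.exists_bound_of_continuousOn hcont
  refine ⟨C.toNNReal, fun x hx => ?_⟩
  have hr := eucl_pos hx
  have hu : eucl ((eucl x)⁻¹ • x) = 1 := by
    rw [eucl_smul (inv_nonneg.2 hr.le), inv_mul_cancel₀ hr.ne']
  have hx' : (eucl x)⁻¹ • x ≠ 0 := smul_ne_zero (inv_ne_zero hr.ne') hx
  have h := hc.map_smul (eucl x) hr _ hx'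
  rw [smul_inv_smul₀ hr.ne'] at h
  rw [h, abs_mul, abs_of_pos (zpow_pos hr d), mul_comm]
  exact mul_le_mul_of_nonneg_right ((hC _ (Set.mem_ofPred.2 hu)).trans (Real.le_coe_toNNReal C))
    (zpow_pos hr d).le

/-- Operators of total order `M` that away from `x = 0` are sums of the terms arising when
a word of length `M` in the operators `Y_j` is expanded by the Leibniz rule. -/
inductive IsComb (n m N : ℕ) : ℕ → (smoothFun n m → Pt n m → ℝ) → Prop
  | pure (a : List (Fin n)) : IsComb n m N a.length fun φ =>
      ((a.map smoothDx).prod φ : smoothFun n m).1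
  | term (M r : ℕ) (a : List (Fin n)) (b : List (Fin m)) (c : (Fin n → ℝ) → ℝ) (hb : b ≠ [])
      (hM : r + b.length + a.length = M) (hc : IsHomog ((N * b.length : ℤ) - r) c) :
      IsComb n m N M fun φ z => c z.1 *
        (((b.map smoothDy).prod * (a.map smoothDx).prod : Module.End ℝ (smoothFun n m)) φ).1 z
  | add (M : ℕ) (S T : smoothFun n m → Pt n m → ℝ) (hS : IsComb n m N M S)
      (hT : IsComb n m N M T) : IsComb n m N M fun φ z => S φ z + T φ z
  | congr (M : ℕ) (S T : smoothFun n m → Pt n m → ℝ) (hS : IsComb n m N M S)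
      (hST : ∀ φ z, z.1 ≠ 0 → S φ z = T φ z) : IsComb n m N M T

theorem eventually_fst_ne_zero {n m : ℕ} {z : Pt n m} (hz : z.1 ≠ 0) :
    ∀ᶠ w in nhds z, w.1 ≠ 0 :=
  continuous_fst.continuousAt.eventually (isOpen_ne.mem_nhds hz)

theorem IsComb.differentiableAt {n m N M : ℕ} {T : smoothFun n m → Pt n m → ℝ}
    (hT : IsComb n m N M T) (φ : smoothFun n m) {z : Pt n m} (hz : z.1 ≠ 0) :
    DifferentiableAt ℝ (T φ) z := by
  induction hT with
  | pure a => exact differentiable_coe _ z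
  | term M r a b c hb hM hc =>
    exact (((hc.contDiffAt z.1 hz).differentiableAt (by simp)).comp z
      differentiableAt_fst).mul (differentiable_coe _ z)
  | add M S T _ _ hS hT => exact hS.add hT
  | congr M S T _ hST hS =>
    exact hS.congr_of_eventuallyEq ((eventually_fst_ne_zero hz).mono fun w hw => (hST φ w hw).symm)

theorem fderiv_comp_fst_mul {n m : ℕ} {c : (Fin n → ℝ) → ℝ} {z : Pt n m}
    (hc : DifferentiableAt ℝ c z.1) (f : smoothFun n m) (v : Pt n m) :
    fderiv ℝ (fun z => c z.1 * f.1 z) z v =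
      fderiv ℝ c z.1 v.1 * f.1 z + c z.1 * (dirDeriv v f).1 z := by
  have h : HasFDerivAt (fun z : Pt n m => c z.1) _ z := hc.hasFDerivAt.comp z hasFDerivAt_fst
  have h' : fderiv ℝ (fun z => c z.1 * f.1 z) z = _ :=
    (h.mul (differentiable_coe f z).hasFDerivAt).fderiv
  rw [h', dirDeriv_apply]
  simp
  ring

theorem IsComb.dx {n m N M : ℕ} {T : smoothFun n m → Pt n m → ℝ} (hT : IsComb n m N M T)
    (j : Fin n) : IsComb n m N (M + 1) fun φ => Dx n m j (T φ) := by
  induction hT with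
  | pure a => exact IsComb.pure (j :: a)
  | term M r a b c hb hM hc =>
    refine .congr _ _ _ (.add _ _ _
      (.term (M + 1) (r + 1) a b (fun x => fderiv ℝ c x (Pi.single j 1)) hb (by omega) ?_)
      (.term (M + 1) r (j :: a) b c hb (by rw [List.length_cons]; omega) hc)) fun φ z hz => ?_
    · convert hc.fderiv_apply (Pi.single j 1) using 1
      push_cast
      ring
    · have hcomm : Commute (smoothDx j : Module.End ℝ (smoothFun n m)) (b.map smoothDy).prod := by
        refine Commute.list_prod_right _ _ fun y hy => ?_
        obtain ⟨k, -, rfl⟩ := List.mem_map.1 hy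
        exact commute_dirDeriv _ _
      rw [Dx, fderiv_comp_fst_mul ((hc.contDiffAt z.1 hz).differentiableAt (by simp)),
        List.map_cons, List.prod_cons, ← mul_assoc, ← hcomm.eq, mul_assoc]
      rfl
  | add M S T hS' hT' hS hT =>
    refine .congr _ _ _ (.add _ _ _ hS hT) fun φ z hz => ?_
    have h : fderiv ℝ (fun z => S φ z + T φ z) z = _ :=
      fderiv_add (hS'.differentiableAt φ hz) (hT'.differentiableAt φ hz)
    rw [Dx, Dx, Dx, h]
    rfl
  | congr M S T _ hST hS =>
    refine .congr _ _ _ hS fun φ z hz => ?_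
    have h : S φ =ᶠ[nhds z] T φ := (eventually_fst_ne_zero hz).mono fun w hw => hST φ w hw
    rw [Dx, Dx, h.fderiv_eq]

theorem IsComb.eucl_pow_mul_dy {n m N M : ℕ} {T : smoothFun n m → Pt n m → ℝ}
    (hT : IsComb n m N M T) (k : Fin m) :
    IsComb n m N (M + 1) fun φ z => eucl z.1 ^ N * Dy n m k (T φ) z := by
  induction hT with
  | pure a =>
    refine .congr _ _ _ (.term (a.length + 1) 0 a [k] (fun x => eucl x ^ N) (by simp)
      (by rw [List.length_singleton]; omega) ?_) fun φ z hz => ?_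
    · simpa using isHomog_eucl_pow N
    · simp only [List.map_cons, List.map_nil, List.prod_cons, List.prod_nil, mul_one]
      rfl
  | term M r a b c hb hM hc =>
    refine .congr _ _ _ (.term (M + 1) r a (k :: b) (fun x => eucl x ^ N * c x) (by simp)
      (by rw [List.length_cons]; omega) ?_) fun φ z hz => ?_
    · convert (isHomog_eucl_pow N).mul hc using 1
      rw [List.length_cons]
      push_cast
      ring
    · rw [Dy, fderiv_comp_fst_mul ((hc.contDiffAt z.1 hz).differentiableAt (by simp)),
        List.map_cons, List.prod_cons, map_zero, zero_mul, zero_add, mul_assoc, mul_assoc]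
      rfl
  | add M S T hS' hT' hS hT =>
    refine .congr _ _ _ (.add _ _ _ hS hT) fun φ z hz => ?_
    have h : fderiv ℝ (fun z => S φ z + T φ z) z = _ :=
      fderiv_add (hS'.differentiableAt φ hz) (hT'.differentiableAt φ hz)
    rw [Dy, Dy, Dy, h, ← mul_add]
    rfl
  | congr M S T _ hST hS =>
    refine .congr _ _ _ hS fun φ z hz => ?_
    have h : S φ =ᶠ[nhds z] T φ := (eventually_fst_ne_zero hz).mono fun w hw => hST φ w hw
    rw [Dy, Dy, h.fderiv_eq]

theorem isComb_compOps_Yop {n m N : ℕ} (l : List (Fin n ⊕ Fin m)) :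
    IsComb n m N l.length fun φ => compOps (l.map (Yop n m N)) φ.1 := by
  induction l with
  | nil => exact IsComb.pure []
  | cons i l ih =>
    rcases i with j | k
    · exact ih.dx j
    · exact ih.eucl_pow_mul_dy k

/-- `T` is controlled in `L_p`, on compactly supported smooth functions, by the words of
length `M` in the operators of `𝒳`. -/
def IsXBounded (n m N M : ℕ) (p : ℝ) (T : smoothFun n m → Pt n m → ℝ) : Prop :=
  ∃ C : ℝ≥0, ∀ φ : smoothFun n m, HasCompactSupport φ.1 →
    eLpNorm (T φ) (ENNReal.ofReal p) volume ≤
      C * ⨆ β : Fin M → XIdx n m N, eLpNorm (Xw β φ.1) (ENNReal.ofReal p) volume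

theorem IsXBounded.of_ae_le_sum {n m N M : ℕ} {p : ℝ} (hp : 1 ≤ p) {ι : Type*} [Fintype ι]
    {S : ι → smoothFun n m → Pt n m → ℝ} {T : smoothFun n m → Pt n m → ℝ}
    (hS : ∀ i, IsXBounded n m N M p (S i))
    (hSm : ∀ i φ, AEStronglyMeasurable (S i φ) volume) (K : ℝ≥0)
    (hT : ∀ φ, ∀ᵐ z, |T φ z| ≤ K * ∑ i, |S i φ z|) : IsXBounded n m N M p T := by
  choose C hC using hS
  refine ⟨K * ∑ i, C i, fun φ hφ => ?_⟩
  have h1 : eLpNorm (T φ) (ENNReal.ofReal p) volume ≤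
      K * eLpNorm (∑ i, fun z => |S i φ z|) (ENNReal.ofReal p) volume := by
    refine (eLpNorm_le_nnreal_smul_eLpNorm_of_ae_le_mul (g := ∑ i, fun z => |S i φ z|) (c := K)
      ?_ _)
    filter_upwards [hT φ] with z hz
    rw [← NNReal.coe_le_coe]
    push_cast
    rw [Real.norm_eq_abs, Real.norm_eq_abs, Finset.sum_apply,
      abs_of_nonneg (a := ∑ i, |S i φ z|) (Finset.sum_nonneg fun i _ => abs_nonneg _)]
    exact hz
  refine h1.trans ?_
  push_cast
  rw [mul_assoc, Finset.sum_mul]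
  gcongr
  refine (eLpNorm_sum_le (fun i _ => (hSm i φ).norm) (ENNReal.one_le_ofReal.2 hp)).trans ?_
  refine Finset.sum_le_sum fun i _ => ?_
  exact (eLpNorm_norm _).trans_le (hC i φ hφ)

theorem IsXBounded.of_ae_le {n m N M : ℕ} {p : ℝ} (hp : 1 ≤ p)
    {S T : smoothFun n m → Pt n m → ℝ} (hS : IsXBounded n m N M p S)
    (hSm : ∀ φ, AEStronglyMeasurable (S φ) volume) (K : ℝ≥0)
    (hT : ∀ φ, ∀ᵐ z, |T φ z| ≤ K * |S φ z|) : IsXBounded n m N M p T :=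
  .of_ae_le_sum (S := fun _ : Unit => S) hp (fun _ => hS) (fun _ => hSm) K (by simpa using hT)

theorem isXBounded_of_mem_spanX_pow {n m N M : ℕ} {p : ℝ} (hp : 1 ≤ p)
    {A : Module.End ℝ (smoothFun n m)} (hA : A ∈ spanX n m N ^ M) :
    IsXBounded n m N M p fun φ => (A φ).1 := by
  obtain ⟨C, hC⟩ := exists_eLpNorm_le_of_mem_spanX_pow hA (ENNReal.one_le_ofReal.2 hp)
  exact ⟨C, fun φ _ => hC φ⟩

theorem eucl_le_sum_abs {n : ℕ} (x : Fin n → ℝ) : eucl x ≤ ∑ i, |x i| := by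
  rw [eucl]
  refine Real.sqrt_le_iff.2 ⟨Finset.sum_nonneg fun i _ => abs_nonneg _, ?_⟩
  simpa using Finset.sum_sq_le_sq_sum_of_nonneg (s := Finset.univ) (f := fun i => |x i|)
    fun i _ => abs_nonneg _

theorem isXBounded_eucl_pow_mul {n m N M d : ℕ} {p : ℝ} (hp : 1 ≤ p)
    {A : Module.End ℝ (smoothFun n m)}
    (hA : ∀ u : List (Fin n), u.length = d → (u.map mulCoord).prod * A ∈ spanX n m N ^ M) :
    IsXBounded n m N M p fun φ z => eucl z.1 ^ d * (A φ).1 z := by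
  refine .of_ae_le_sum (ι := Fin d → Fin n)
    (S := fun f φ =>
      (((((List.ofFn f).map mulCoord).prod * A : Module.End ℝ (smoothFun n m)) φ).1)) hp
    (fun f => isXBounded_of_mem_spanX_pow hp (hA (List.ofFn f) List.length_ofFn))
    (fun f φ => (contDiff_coe _).continuous.aestronglyMeasurable) 1 fun φ => .of_forall fun z => ?_
  simp only [Module.End.mul_apply, list_prod_mulCoord_apply]
  simp only [List.map_ofFn, List.prod_ofFn, abs_mul, Finset.abs_prod,
    NNReal.coe_one, one_mul, ← Finset.sum_mul, Function.comp_apply]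
  rw [← Fintype.sum_pow (fun i => |z.1 i|) d, abs_pow, abs_of_nonneg (eucl_nonneg _)]
  gcongr
  · exact eucl_nonneg _
  · exact eucl_le_sum_abs _

theorem aestronglyMeasurable_eucl_rpow_mul {n m : ℕ} (s : ℝ) (f : smoothFun n m) :
    AEStronglyMeasurable (fun z => eucl z.1 ^ s * f.1 z) volume :=
  ((((continuous_eucl.comp continuous_fst).measurable.pow_const s).mul
    (contDiff_coe f).continuous.measurable)).aestronglyMeasurable

theorem isXBounded_eucl_rpow_neg_mul {n m N M : ℕ} {p κ : ℝ} (hp : 1 < p) (hκ : 0 < κ)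
    (hκn : κ * p < n) {A : Module.End ℝ (smoothFun n m)}
    (hA : ∀ φ, HasCompactSupport φ.1 → HasCompactSupport (A φ).1)
    (h : ∀ i, IsXBounded n m N M p fun φ z => eucl z.1 ^ (1 - κ) * (smoothDx i (A φ)).1 z) :
    IsXBounded n m N M p fun φ z => eucl z.1 ^ (-κ) * (A φ).1 z := by
  obtain ⟨C, hC⟩ := eLpNorm_eucl_rpow_mul_le (m := m) hp hκ hκn
  have hsum : IsXBounded n m N M p fun φ z =>
      eucl z.1 ^ (1 - κ) * ∑ i, |(smoothDx i (A φ)).1 z| := by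
    refine .of_ae_le_sum hp.le h (fun i φ => aestronglyMeasurable_eucl_rpow_mul _ _) 1
      fun φ => .of_forall fun z => le_of_eq ?_
    have h0 : |eucl z.1 ^ (1 - κ)| = eucl z.1 ^ (1 - κ) :=
      abs_of_nonneg (Real.rpow_nonneg (eucl_nonneg _) _)
    simp only [abs_mul, ← Finset.mul_sum, h0, NNReal.coe_one, one_mul]
    rw [abs_of_nonneg (Finset.sum_nonneg fun i _ => abs_nonneg _)]
  obtain ⟨C', hC'⟩ := hsum
  refine ⟨C * C', fun φ hφ => ?_⟩
  refine (hC _ ((contDiff_coe (A φ)).of_le (by simp)) (hA φ hφ)).trans ?_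
  push_cast
  rw [mul_assoc]
  gcongr
  exact hC' φ hφ

theorem hasCompactSupport_dirDeriv {n m : ℕ} (v : Pt n m) {f : smoothFun n m}
    (hf : HasCompactSupport f.1) : HasCompactSupport (dirDeriv v f).1 :=
  hf.fderiv_apply ℝ v

theorem IsHomog.isXBounded_mul {n m N r : ℕ} {p : ℝ} (hN : 1 ≤ N) (hp : 1 < p)
    (hpn : 2 * p < n) {a : List (Fin n)} {b : List (Fin m)} (hb : b ≠ [])
    (hr : r + b.length + a.length = N + 3) {c : (Fin n → ℝ) → ℝ}
    (hc : IsHomog ((N * b.length : ℤ) - r) c) :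
    IsXBounded n m N (N + 3) p fun φ z => c z.1 *
      (((b.map smoothDy).prod * (a.map smoothDx).prod : Module.End ℝ (smoothFun n m)) φ).1 z := by
  have hn : 0 < n := by
    have : (0 : ℝ) < n := by linarith
    exact_mod_cast this
  obtain ⟨K, hK⟩ := hc.exists_abs_le
  have hDxy (k : Fin m) (i j : Fin n) : smoothDx i * (smoothDx j * smoothDy k) ∈
      (spanX n m N ^ (N + 3) : Submodule ℝ (Module.End ℝ (smoothFun n m))) := by
    have h := mem_spanX_pow (N := N) hn N [] [k] [i, j] (by simp)
    have hcomm : Commute (smoothDx i * smoothDx j : Module.End ℝ (smoothFun n m)) (smoothDy k) :=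
      (commute_dirDeriv _ _).mul_left (commute_dirDeriv _ _)
    rw [← mul_assoc, hcomm.eq]
    simpa [mul_assoc] using h
  have hcd (k : Fin m) (j : Fin n) : IsXBounded n m N (N + 3) p fun φ z =>
      eucl z.1 ^ (-1 : ℝ) *
        ((smoothDx j * smoothDy k : Module.End ℝ (smoothFun n m)) φ).1 z := by
    refine isXBounded_eucl_rpow_neg_mul hp one_pos (by linarith)
      (fun φ hφ => hasCompactSupport_dirDeriv _ (hasCompactSupport_dirDeriv _ hφ)) fun i => ?_
    simpa using isXBounded_of_mem_spanX_pow hp.le (hDxy k i j)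
  rcases le_or_gt (r : ℤ) (N * b.length) with hd | hd
  · have hd' : r ≤ N * b.length := by exact_mod_cast hd
    obtain ⟨d, hd⟩ := Nat.exists_eq_add_of_le' hd'
    refine .of_ae_le hp.le (isXBounded_eucl_pow_mul (d := d)
      (A := (b.map smoothDy).prod * (a.map smoothDx).prod) hp.le fun u hu => ?_)
      (fun φ => ?_) K fun φ => ?_
    · rw [← hr]
      exact mem_spanX_pow hn r u b a (by omega)
    · exact (((continuous_eucl.comp continuous_fst).pow d).mul
        (contDiff_coe _).continuous).aestronglyMeasurable
    · filter_upwards [ae_fst_ne_zero hn] with z hz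
      have h := hK z.1 hz
      rw [show (N * b.length : ℤ) - r = d by rw [sub_eq_iff_eq_add]; exact_mod_cast hd,
        zpow_natCast] at h
      rw [abs_mul, abs_mul, abs_pow, abs_of_nonneg (eucl_nonneg z.1), ← mul_assoc]
      gcongr
  · have hd' : N * b.length < r := by exact_mod_cast hd
    have hb0 : 0 < b.length := List.length_pos_iff.2 hb
    have hb1 : b.length = 1 := by
      by_contra hb1
      obtain ⟨s, hs⟩ := Nat.exists_eq_add_of_le (show 2 ≤ b.length by omega)
      rw [hs] at hd' hr
      nlinarith
    obtain ⟨k, rfl⟩ := List.length_eq_one_iff.1 hb1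
    have habs (e : ℤ) (he : (N * ([k] : List (Fin m)).length : ℤ) - r = e)
        (f : smoothFun n m) : ∀ᵐ z : Pt n m, |c z.1 * f.1 z| ≤ K * |eucl z.1 ^ (e : ℝ) * f.1 z| := by
      filter_upwards [ae_fst_ne_zero hn] with z hz
      have h := hK z.1 hz
      rw [he] at h
      rw [abs_mul, abs_mul, Real.rpow_intCast, abs_of_nonneg (zpow_nonneg (eucl_nonneg z.1) _),
        ← mul_assoc]
      gcongr
    rw [List.length_singleton] at hd' hr
    rcases a with _ | ⟨j, a⟩
    · rw [List.length_nil] at hr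
      refine .of_ae_le hp.le ?_ (fun φ => aestronglyMeasurable_eucl_rpow_mul _ _) K fun φ =>
        habs (-2) (by rw [List.length_singleton]; omega) _
      have h2 : IsXBounded n m N (N + 3) p fun φ z =>
          eucl z.1 ^ (-2 : ℝ) * (smoothDy k φ : smoothFun n m).1 z := by
        refine isXBounded_eucl_rpow_neg_mul hp two_pos hpn
          (fun φ hφ => hasCompactSupport_dirDeriv _ hφ) fun j => ?_
        have h : (1 : ℝ) - 2 = -1 := by norm_num
        rw [h]
        exact hcd k j
      simpa using h2
    · rw [List.length_cons] at hr
      obtain rfl : a = [] := List.length_eq_zero_iff.1 (by omega)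
      rw [List.length_nil] at hr
      refine .of_ae_le hp.le ?_ (fun φ => aestronglyMeasurable_eucl_rpow_mul _ _) K fun φ =>
        habs (-1) (by rw [List.length_singleton]; omega) _
      have hcomm : Commute (smoothDx j : Module.End ℝ (smoothFun n m)) (smoothDy k) :=
        commute_dirDeriv _ _
      have h1 := hcd k j
      rw [hcomm.eq] at h1
      simpa using h1

theorem IsComb.aestronglyMeasurable {n m N M : ℕ} (hn : 0 < n) {T : smoothFun n m → Pt n m → ℝ}
    (hT : IsComb n m N M T) (φ : smoothFun n m) : AEStronglyMeasurable (T φ) volume := by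
  have ho : IsOpen {z : Pt n m | z.1 ≠ 0} := isOpen_ne.preimage continuous_fst
  have h : ContinuousOn (T φ) {z : Pt n m | z.1 ≠ 0} := fun z hz =>
    (hT.differentiableAt φ hz).continuousAt.continuousWithinAt
  have h' := h.aestronglyMeasurable ho.measurableSet (μ := volume)
  have hs : ∀ᵐ z : Pt n m, z ∈ {z : Pt n m | z.1 ≠ 0} := ae_fst_ne_zero hn
  rwa [Measure.restrict_eq_self_of_ae_mem hs] at h'

theorem IsComb.isXBounded {n m N M : ℕ} {p : ℝ} (hN : 1 ≤ N) (hp : 1 < p) (hpn : 2 * p < n)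
    {T : smoothFun n m → Pt n m → ℝ} (hT : IsComb n m N M T) (hM : M = N + 3) :
    IsXBounded n m N (N + 3) p T := by
  have hn : 0 < n := by
    have : (0 : ℝ) < n := by linarith
    exact_mod_cast this
  induction hT with
  | pure a =>
    rw [← hM]
    refine isXBounded_of_mem_spanX_pow hp.le ?_
    simpa using mem_spanX_pow hn 0 [] ([] : List (Fin m)) a (by simp)
  | term M r a b c hb hr hc => exact hc.isXBounded_mul hN hp hpn hb (hr.trans hM)
  | add M S T hS' hT' hS hT =>
    refine .of_ae_le_sum (ι := Bool) (S := fun i => bif i then S else T) hp.le ?_ ?_ 1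
      fun φ => .of_forall fun z => ?_
    · rintro (_ | _)
      exacts [hT hM, hS hM]
    · rintro (_ | _)
      exacts [hT'.aestronglyMeasurable hn, hS'.aestronglyMeasurable hn]
    · simpa using abs_add_le (S φ z) (T φ z)
  | congr M S T hS' hST hS =>
    refine .of_ae_le hp.le (hS hM) (hS'.aestronglyMeasurable hn) 1 fun φ => ?_
    filter_upwards [ae_fst_ne_zero hn] with z hz
    rw [hST φ z hz, NNReal.coe_one, one_mul]

/-- (Corollary 3.2, comparison form.)  For `n ≥ 3`, `m, N ≥ 1` and
`p ∈ (1, n/2)`, there is `c > 0` such that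
`‖Y^α φ‖_p ≤ c · max_{|β| = N+3} ‖X^β φ‖_p` for all `φ ∈ C_c^∞(ℝ^(n+m))` and all words
`α ∈ {1,…,n+m}^(N+3)`. -/
theorem Y_riesz_order_N_plus_three_small_p
    (n m N : ℕ) (hn : 3 ≤ n) (hm : 1 ≤ m) (hN : 1 ≤ N)
    (p : ℝ) (hp : 1 < p) (hpn : p < (n : ℝ) / 2) :
    ∃ c > (0 : ℝ), ∀ φ : Pt n m → ℝ, ContDiff ℝ (⊤ : ℕ∞) φ → HasCompactSupport φ →
      ∀ α : Fin (N + 3) → (Fin n ⊕ Fin m),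
        eLpNorm (Yw (N := N) α φ) (ENNReal.ofReal p) volume ≤
          ENNReal.ofReal c *
            ⨆ β : Fin (N + 3) → XIdx n m N, eLpNorm (Xw β φ) (ENNReal.ofReal p) volume := by
  have key (α : Fin (N + 3) → (Fin n ⊕ Fin m)) :
      IsXBounded n m N (N + 3) p fun φ => Yw (N := N) α φ.1 := by
    have h := (isComb_compOps_Yop (N := N) (List.ofFn α)).isXBounded hN hp (by linarith)
      List.length_ofFn
    rwa [List.map_ofFn] at h
  choose C hC using key
  refine ⟨1 + ∑ α, C α, by positivity, fun φ hφ hφc α => ?_⟩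
  refine (hC α ⟨φ, mem_smoothFun.2 hφ⟩ hφc).trans ?_
  gcongr
  rw [← ENNReal.ofReal_coe_nnreal]
  refine ENNReal.ofReal_le_ofReal ?_
  have h := Finset.single_le_sum (f := fun α => (C α : ℝ)) (fun i _ => (C i).coe_nonneg)
    (Finset.mem_univ α)
  push_cast
  linarith
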